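/- arXiv:2210.09247 — 9 statements merged into one kernel-verified Lean document; each statement's English description precedes it below -/
import Mathlib

section
/- Let f be a time-varying discrete-time system that is flat along a trajectory (x̄,ū), with window lengths q₁,q₂,r₁,r₂, open sets U, V, flat output Φ, parameterization F = (F_x,F_u), and reference flat-output trajectory ȳ(k) := Φ(k, W_k^{q₁,q₂}(x̄,ū)). Let dΦ_k denote the derivative of Φ(k,·) at the point W_k^{q₁,q₂}(x̄,ū) and dF_k = (dF_{x,k}, dF_{u,k}) the derivative of F(k,·) at the point W_k^{r₁,r₂}(ȳ). Then the linearization of f along (x̄,ū) is flat, with flat output the linearization of Φ and parameterization the linearization of F. Precisely: (a) for every trajectory (Δx,Δu) of the linearized system, the sequence Δy(k) := dΦ_k[((Δx(k−q₁),Δu(k−q₁)),…,(Δx(k+q₂),Δu(k+q₂)))] satisfies (Δx(k),Δu(k)) = dF_k[(Δy(k−r₁),…,Δy(k+r₂))] for all k ∈ ℤ; and (b) for every sequence Δy : ℤ → ℝ^m, the pair Δx(k) := dF_{x,k}[(Δy(k−r₁),…,Δy(k+r₂))], Δu(k) := dF_{u,k}[(Δy(k−r₁),…,Δy(k+r₂))]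 is a trajectory of the linearized system and satisfies dΦ_k[((Δx(k−q₁),Δu(k−q₁)),…,(Δx(k+q₂),Δu(k+q₂)))] = Δy(k) for all k ∈ ℤ. -/
open Filter Topology

noncomputable section

/-- `Vec d` is the state/input space `ℝ^d`. -/
abbrev Vec (d : ℕ) : Type := Fin d → ℝ

/-- A trajectory of the time-varying discrete-time system `x⁺ = f(k,x,u)`. -/
def IsTrajectory (n m : ℕ) (f : ℤ → Vec n → Vec m → Vec n)
    (x : ℤ → Vec n) (u : ℤ → Vec m) : Prop :=
  ∀ k : ℤ, x (k + 1) = f k (x k) (u k)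

/-- A trajectory of the linearization of `f` along the trajectory `(xb, ub)`:
`Δx(k+1) = A(k) Δx(k) + B(k) Δu(k)` with `A(k) = D_x f(k, xb k, ub k)`,
`B(k) = D_u f(k, xb k, ub k)`. -/
def IsLinTrajectory (n m : ℕ) (f : ℤ → Vec n → Vec m → Vec n)
    (xb : ℤ → Vec n) (ub : ℤ → Vec m)
    (Δx : ℤ → Vec n) (Δu : ℤ → Vec m) : Prop :=
  ∀ k : ℤ, Δx (k + 1) =
    fderiv ℝ (fun x => f k x (ub k)) (xb k) (Δx k) +
    fderiv ℝ (fun u => f k (xb k) u) (ub k) (Δu k)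

/-- The window `W_k^{q₁,q₂}(x,u) = ((x(k-q₁),u(k-q₁)),…,(x(k+q₂),u(k+q₂)))`. -/
def pairWin (n m q₁ q₂ : ℕ) (x : ℤ → Vec n) (u : ℤ → Vec m) (k : ℤ) :
    Fin (q₁ + q₂ + 1) → Vec n × Vec m :=
  fun i => (x (k - q₁ + (i : ℕ)), u (k - q₁ + (i : ℕ)))

/-- The window `W_k^{r₁,r₂}(y) = (y(k-r₁),…,y(k+r₂))`. -/
def seqWin (m r₁ r₂ : ℕ) (y : ℤ → Vec m) (k : ℤ) :
    Fin (r₁ + r₂ + 1) → Vec m :=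
  fun i => y (k - r₁ + (i : ℕ))

/-- The data `(q₁,q₂,r₁,r₂,U,V,Φ,F)` witnessing flatness of the system `f`
along the trajectory `(xb, ub)`, conditions (F1)–(F4). -/
structure FlatData (n m : ℕ) (f : ℤ → Vec n → Vec m → Vec n)
    (xb : ℤ → Vec n) (ub : ℤ → Vec m) (q₁ q₂ r₁ r₂ : ℕ)
    (U : Set (Fin (q₁ + q₂ + 1) → Vec n × Vec m))
    (V : Set (Fin (r₁ + r₂ + 1) → Vec m))
    (Φ : ℤ → (Fin (q₁ + q₂ + 1) → Vec n × Vec m) → Vec m)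
    (F : ℤ → (Fin (r₁ + r₂ + 1) → Vec m) → Vec n × Vec m) : Prop where
  traj : IsTrajectory n m f xb ub
  openU : IsOpen U
  openV : IsOpen V
  smoothPhi : ∀ k : ℤ, ContDiffOn ℝ (⊤ : ℕ∞) (Φ k) U
  smoothF : ∀ k : ℤ, ContDiffOn ℝ (⊤ : ℕ∞) (F k) V
  /-- (F1), first half: the reference windows lie in `U`. -/
  memU : ∀ k : ℤ, pairWin n m q₁ q₂ xb ub k ∈ U
  /-- (F1), second half: the windows of the reference flat output lie in `V`. -/
  memV : ∀ k : ℤ,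
    seqWin m r₁ r₂ (fun j => Φ j (pairWin n m q₁ q₂ xb ub j)) k ∈ V
  /-- (F2): the parameterization satisfies the system equations. -/
  F2 : ∀ (k : ℤ) (y : ℤ → Vec m),
    seqWin m r₁ r₂ y k ∈ V → seqWin m r₁ r₂ y (k + 1) ∈ V →
    (F (k + 1) (seqWin m r₁ r₂ y (k + 1))).1 =
      f k (F k (seqWin m r₁ r₂ y k)).1 (F k (seqWin m r₁ r₂ y k)).2
  /-- (F3): `Φ` is a left inverse of the parameterization. -/
  F3 : ∀ (k : ℤ) (y : ℤ → Vec m),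
    (∀ j : ℤ, k - q₁ ≤ j → j ≤ k + q₂ → seqWin m r₁ r₂ y j ∈ V) →
    (fun i : Fin (q₁ + q₂ + 1) =>
        F (k - q₁ + (i : ℕ)) (seqWin m r₁ r₂ y (k - q₁ + (i : ℕ)))) ∈ U →
    Φ k (fun i : Fin (q₁ + q₂ + 1) =>
        F (k - q₁ + (i : ℕ)) (seqWin m r₁ r₂ y (k - q₁ + (i : ℕ)))) = y k
  /-- (F4): `F` recovers a solution from the values of its flat output. -/
  F4 : ∀ (k : ℤ) (x : ℤ → Vec n) (u : ℤ → Vec m),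
    (∀ j : ℤ, k - r₁ - q₁ ≤ j → j < k + r₂ + q₂ → x (j + 1) = f j (x j) (u j)) →
    (∀ j : ℤ, k - r₁ ≤ j → j ≤ k + r₂ → pairWin n m q₁ q₂ x u j ∈ U) →
    seqWin m r₁ r₂ (fun j => Φ j (pairWin n m q₁ q₂ x u j)) k ∈ V →
    (x k, u k) = F k (seqWin m r₁ r₂ (fun j => Φ j (pairWin n m q₁ q₂ x u j)) k)

/-- The reference flat-output trajectory `ȳ(k) = Φ(k, W_k^{q₁,q₂}(x̄,ū))`. -/
def refOut (n m q₁ q₂ : ℕ) (Φ : ℤ → (Fin (q₁ + q₂ + 1) → Vec n × Vec m) → Vec m)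
    (xb : ℤ → Vec n) (ub : ℤ → Vec m) : ℤ → Vec m :=
  fun k => Φ k (pairWin n m q₁ q₂ xb ub k)

/-- The system `f` is flat along the trajectory `(xb, ub)`. -/
def IsFlatAlong (n m : ℕ) (f : ℤ → Vec n → Vec m → Vec n)
    (xb : ℤ → Vec n) (ub : ℤ → Vec m) : Prop :=
  ∃ (q₁ q₂ r₁ r₂ : ℕ) (U : Set (Fin (q₁ + q₂ + 1) → Vec n × Vec m))
    (V : Set (Fin (r₁ + r₂ + 1) → Vec m))
    (Φ : ℤ → (Fin (q₁ + q₂ + 1) → Vec n × Vec m) → Vec m)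
    (F : ℤ → (Fin (r₁ + r₂ + 1) → Vec m) → Vec n × Vec m),
    FlatData n m f xb ub q₁ q₂ r₁ r₂ U V Φ F

/-- `f` is submersive along `(xb, ub)`: the Jacobian of `f(k,·,·)` at
`(xb k, ub k)` is surjective for every `k`. -/
def IsSubmersiveAlong (n m : ℕ) (f : ℤ → Vec n → Vec m → Vec n)
    (xb : ℤ → Vec n) (ub : ℤ → Vec m) : Prop :=
  ∀ k : ℤ, Function.Surjective
    ⇑(fderiv ℝ (Function.uncurry (f k)) (xb k, ub k))


/-- The total derivative is the sum of the partial derivatives. -/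
lemma fderiv_uncurry_apply {E₁ E₂ G : Type*} [NormedAddCommGroup E₁] [NormedSpace ℝ E₁]
    [NormedAddCommGroup E₂] [NormedSpace ℝ E₂] [NormedAddCommGroup G] [NormedSpace ℝ G]
    {g : E₁ → E₂ → G} {a : E₁} {b : E₂} (h : DifferentiableAt ℝ (Function.uncurry g) (a, b))
    (v : E₁) (w : E₂) :
    fderiv ℝ (Function.uncurry g) (a, b) (v, w) =
      fderiv ℝ (fun x => g x b) a v + fderiv ℝ (fun y => g a y) b w := by
  have h₁ := HasFDerivAt.comp (f := fun x : E₁ => (x, b)) a h.hasFDerivAt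
    (hasFDerivAt_prodMk_left (𝕜 := ℝ) a b)
  have h₂ := HasFDerivAt.comp (f := fun y : E₂ => (a, y)) b h.hasFDerivAt
    (hasFDerivAt_prodMk_right (𝕜 := ℝ) a b)
  have e₁ : fderiv ℝ (fun x => g x b) a = _ := h₁.fderiv
  have e₂ : fderiv ℝ (fun y => g a y) b = _ := h₂.fderiv
  rw [e₁, e₂]
  simp [← map_add]

/-- The state reached after a given number of steps from `x₀` at time `k₀` under the input `u`. -/
def forwardState {n m : ℕ} (f : ℤ → Vec n → Vec m → Vec n) (k₀ : ℤ) (x₀ : Vec n)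
    (u : ℤ → Vec m) : ℕ → Vec n
  | 0 => x₀
  | N + 1 => f (k₀ + N) (forwardState f k₀ x₀ u N) (u (k₀ + N))

lemma forwardState_eq {n m : ℕ} {f : ℤ → Vec n → Vec m → Vec n} {x : ℤ → Vec n} {u : ℤ → Vec m}
    (h : IsTrajectory n m f x u) (k₀ : ℤ) (N : ℕ) :
    forwardState f k₀ (x k₀) u N = x (k₀ + N) := by
  induction N with
  | zero => simp [forwardState]
  | succ N ih => rw [forwardState, ih, ← h]; push_cast; rw [add_assoc]

lemma hasDerivAt_add_smul {E : Type*} [NormedAddCommGroup E] [NormedSpace ℝ E] (a v : E) :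
    HasDerivAt (fun s : ℝ => a + s • v) v 0 := by
  simpa using ((hasDerivAt_id (0 : ℝ)).smul_const v).const_add a

/-- The solution with initial state and input perturbed along a trajectory of the linearization
depends differentiably on the perturbation parameter, with the expected derivative. -/
lemma hasDerivAt_forwardState {n m : ℕ} {f : ℤ → Vec n → Vec m → Vec n}
    (hf : ∀ k, Differentiable ℝ (Function.uncurry (f k)))
    {xb : ℤ → Vec n} {ub : ℤ → Vec m} (hb : IsTrajectory n m f xb ub)
    {Δx : ℤ → Vec n} {Δu : ℤ → Vec m} (hΔ : IsLinTrajectory n m f xb ub Δx Δu)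
    (k₀ : ℤ) (N : ℕ) :
    HasDerivAt (fun s : ℝ => forwardState f k₀ (xb k₀ + s • Δx k₀) (fun j => ub j + s • Δu j) N)
      (Δx (k₀ + N)) 0 := by
  induction N with
  | zero => simpa [forwardState] using hasDerivAt_add_smul (xb k₀) (Δx k₀)
  | succ N ih =>
    have hp := ih.prodMk (hasDerivAt_add_smul (ub (k₀ + N)) (Δu (k₀ + N)))
    have hD := (hf (k₀ + N) (xb (k₀ + N), ub (k₀ + N))).hasFDerivAt
    have hc := hD.comp_hasDerivAt_of_eq (0 : ℝ) hp (by simp [forwardState_eq hb])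
    rw [fderiv_uncurry_apply (hf _ _), ← hΔ] at hc
    have e : k₀ + ((N + 1 : ℕ) : ℤ) = k₀ + N + 1 := by push_cast; ring
    rw [e]
    exact hc

lemma hasDerivAt_pairWin {n m q₁ q₂ : ℕ} {x : ℝ → ℤ → Vec n} {u : ℝ → ℤ → Vec m}
    {Δx : ℤ → Vec n} {Δu : ℤ → Vec m} {k : ℤ}
    (h : ∀ j, k - q₁ ≤ j → j ≤ k + q₂ →
      HasDerivAt (fun s => (x s j, u s j)) (Δx j, Δu j) 0) :
    HasDerivAt (fun s => pairWin n m q₁ q₂ (x s) (u s) k) (pairWin n m q₁ q₂ Δx Δu k) 0 :=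
  hasDerivAt_pi.2 fun i => h _ (by omega) (by omega)

lemma hasDerivAt_seqWin {m r₁ r₂ : ℕ} {y : ℝ → ℤ → Vec m} {Δy : ℤ → Vec m} {k : ℤ}
    (h : ∀ j, k - r₁ ≤ j → j ≤ k + r₂ → HasDerivAt (fun s => y s j) (Δy j) 0) :
    HasDerivAt (fun s => seqWin m r₁ r₂ (y s) k) (seqWin m r₁ r₂ Δy k) 0 :=
  hasDerivAt_pi.2 fun i => h _ (by omega) (by omega)

lemma eventually_forall_int_Icc {α : Type*} {l : Filter α} {p : α → ℤ → Prop} {a b : ℤ}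
    (h : ∀ j, a ≤ j → j ≤ b → ∀ᶠ s in l, p s j) :
    ∀ᶠ s in l, ∀ j, a ≤ j → j ≤ b → p s j := by
  have := (Set.finite_Icc a b).eventually_all (l := l) (p := fun j s => p s j) |>.2
    fun j hj => h j hj.1 hj.2
  filter_upwards [this] with s hs j h₁ h₂ using hs j ⟨h₁, h₂⟩

namespace FlatData

variable {n m : ℕ} {f : ℤ → Vec n → Vec m → Vec n} {xb : ℤ → Vec n} {ub : ℤ → Vec m}
  {q₁ q₂ r₁ r₂ : ℕ} {U : Set (Fin (q₁ + q₂ + 1) → Vec n × Vec m)}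
  {V : Set (Fin (r₁ + r₂ + 1) → Vec m)}
  {Φ : ℤ → (Fin (q₁ + q₂ + 1) → Vec n × Vec m) → Vec m}
  {F : ℤ → (Fin (r₁ + r₂ + 1) → Vec m) → Vec n × Vec m}

lemma hasFDerivAt_flatOutput (h : FlatData n m f xb ub q₁ q₂ r₁ r₂ U V Φ F) (k : ℤ) :
    HasFDerivAt (Φ k) (fderiv ℝ (Φ k) (pairWin n m q₁ q₂ xb ub k))
      (pairWin n m q₁ q₂ xb ub k) :=
  (((h.smoothPhi k).contDiffAt (h.openU.mem_nhds (h.memU k))).differentiableAt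
    (by simp)).hasFDerivAt

lemma hasFDerivAt_parameterization (h : FlatData n m f xb ub q₁ q₂ r₁ r₂ U V Φ F) (k : ℤ) :
    HasFDerivAt (F k) (fderiv ℝ (F k) (seqWin m r₁ r₂ (refOut n m q₁ q₂ Φ xb ub) k))
      (seqWin m r₁ r₂ (refOut n m q₁ q₂ Φ xb ub) k) :=
  (((h.smoothF k).contDiffAt (h.openV.mem_nhds (h.memV k))).differentiableAt
    (by simp)).hasFDerivAt

lemma parameterization_refOut (h : FlatData n m f xb ub q₁ q₂ r₁ r₂ U V Φ F) (k : ℤ) :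
    F k (seqWin m r₁ r₂ (refOut n m q₁ q₂ Φ xb ub) k) = (xb k, ub k) :=
  (h.F4 k xb ub (fun j _ _ => h.traj j) (fun j _ _ => h.memU j) (h.memV k)).symm

/-- Linearization of (F4). -/
lemma fderiv_parameterization_flatOutput (h : FlatData n m f xb ub q₁ q₂ r₁ r₂ U V Φ F)
    (hf : ∀ k, Differentiable ℝ (Function.uncurry (f k)))
    {Δx : ℤ → Vec n} {Δu : ℤ → Vec m} (hΔ : IsLinTrajectory n m f xb ub Δx Δu)
    {Δy : ℤ → Vec m}
    (hy : ∀ k, Δy k = fderiv ℝ (Φ k) (pairWin n m q₁ q₂ xb ub k) (pairWin n m q₁ q₂ Δx Δu k))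
    (k : ℤ) :
    (Δx k, Δu k) = fderiv ℝ (F k) (seqWin m r₁ r₂ (refOut n m q₁ q₂ Φ xb ub) k)
      (seqWin m r₁ r₂ Δy k) := by
  set k₀ : ℤ := k - r₁ - q₁ with hk₀
  let u : ℝ → ℤ → Vec m := fun s j => ub j + s • Δu j
  let x : ℝ → ℤ → Vec n := fun s j => forwardState f k₀ (xb k₀ + s • Δx k₀) (u s) (j - k₀).toNat
  let y : ℝ → ℤ → Vec m := fun s j => Φ j (pairWin n m q₁ q₂ (x s) (u s) j)
  have hu0 : u 0 = ub := by ext; simp [u]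
  have toNat_eq : ∀ j, k₀ ≤ j → k₀ + ((j - k₀).toNat : ℤ) = j := fun j hj => by omega
  have hx0 : ∀ j, k₀ ≤ j → x 0 j = xb j := fun j hj => by
    simp only [x, hu0, zero_smul, add_zero]
    rw [forwardState_eq h.traj, toNat_eq j hj]
  have hx : ∀ j, k₀ ≤ j → HasDerivAt (fun s => x s j) (Δx j) 0 := fun j hj => by
    have := hasDerivAt_forwardState hf h.traj hΔ k₀ (j - k₀).toNat
    rwa [toNat_eq j hj] at this
  have hxu : ∀ j, k₀ ≤ j → HasDerivAt (fun s => (x s j, u s j)) (Δx j, Δu j) 0 := fun j hj =>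
    (hx j hj).prodMk (hasDerivAt_add_smul _ _)
  have hsol : ∀ s j, k₀ ≤ j → x s (j + 1) = f j (x s j) (u s j) := fun s j hj => by
    have e : (j + 1 - k₀).toNat = (j - k₀).toNat + 1 := by omega
    simp only [x, e, forwardState, toNat_eq j hj]
  have hW0 : ∀ j, k - r₁ ≤ j → pairWin n m q₁ q₂ (x 0) (u 0) j = pairWin n m q₁ q₂ xb ub j :=
    fun j hj => by
      funext i
      simp only [pairWin, hu0]
      rw [hx0 _ (by omega)]
  have hW : ∀ j, k - r₁ ≤ j → HasDerivAt (fun s => pairWin n m q₁ q₂ (x s) (u s) j)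
      (pairWin n m q₁ q₂ Δx Δu j) 0 := fun j hj =>
    hasDerivAt_pairWin fun i hi _ => hxu i (by omega)
  have hY : ∀ j, k - r₁ ≤ j → HasDerivAt (fun s => y s j) (Δy j) 0 := fun j hj => by
    rw [hy j]
    exact (h.hasFDerivAt_flatOutput j).comp_hasDerivAt_of_eq (0 : ℝ) (hW j hj) (hW0 j hj).symm
  have hS : HasDerivAt (fun s => seqWin m r₁ r₂ (y s) k) (seqWin m r₁ r₂ Δy k) 0 :=
    hasDerivAt_seqWin fun j hj _ => hY j hj
  have hS0 : seqWin m r₁ r₂ (y 0) k = seqWin m r₁ r₂ (refOut n m q₁ q₂ Φ xb ub) k := by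
    funext i
    simp only [seqWin, y, refOut]
    rw [hW0 _ (by omega)]
  have hevU : ∀ᶠ s in 𝓝 (0 : ℝ), ∀ j, k - r₁ ≤ j → j ≤ k + r₂ →
      pairWin n m q₁ q₂ (x s) (u s) j ∈ U :=
    eventually_forall_int_Icc fun j hj _ =>
      (hW j hj).continuousAt.eventually_mem
        (h.openU.mem_nhds (by rw [hW0 j hj]; exact h.memU j))
  have hevV : ∀ᶠ s in 𝓝 (0 : ℝ), seqWin m r₁ r₂ (y s) k ∈ V :=
    hS.continuousAt.eventually_mem (h.openV.mem_nhds (by rw [hS0]; exact h.memV k))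
  have hev : (fun s => (x s k, u s k)) =ᶠ[𝓝 0] fun s => F k (seqWin m r₁ r₂ (y s) k) := by
    filter_upwards [hevU, hevV] with s hsU hsV
    exact h.F4 k (x s) (u s) (fun j hj _ => hsol s j hj) hsU hsV
  have hF : HasDerivAt (fun s => F k (seqWin m r₁ r₂ (y s) k)) _ 0 :=
    (h.hasFDerivAt_parameterization k).comp_hasDerivAt_of_eq (0 : ℝ) hS hS0.symm
  exact (hxu k (by omega)).unique (hF.congr_of_eventuallyEq hev)

lemma hasDerivAt_seqWin_refOut_add_smul (Φ : ℤ → (Fin (q₁ + q₂ + 1) → Vec n × Vec m) → Vec m)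
    (xb : ℤ → Vec n) (ub : ℤ → Vec m) (r₁ r₂ : ℕ) (Δy : ℤ → Vec m) (k : ℤ) :
    HasDerivAt
      (fun s : ℝ => seqWin m r₁ r₂ (fun j => refOut n m q₁ q₂ Φ xb ub j + s • Δy j) k)
      (seqWin m r₁ r₂ Δy k) 0 :=
  hasDerivAt_seqWin fun _ _ _ => hasDerivAt_add_smul _ _

lemma eventually_seqWin_mem (h : FlatData n m f xb ub q₁ q₂ r₁ r₂ U V Φ F)
    (Δy : ℤ → Vec m) (k : ℤ) :
    ∀ᶠ s in 𝓝 (0 : ℝ),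
      seqWin m r₁ r₂ (fun j => refOut n m q₁ q₂ Φ xb ub j + s • Δy j) k ∈ V :=
  (hasDerivAt_seqWin_refOut_add_smul Φ xb ub r₁ r₂ Δy k).continuousAt.eventually_mem
    (h.openV.mem_nhds (by simpa [refOut] using h.memV k))

lemma hasDerivAt_parameterization (h : FlatData n m f xb ub q₁ q₂ r₁ r₂ U V Φ F)
    {Δy : ℤ → Vec m} {Δx : ℤ → Vec n} {Δu : ℤ → Vec m}
    (hΔ : ∀ k, (Δx k, Δu k) =
      fderiv ℝ (F k) (seqWin m r₁ r₂ (refOut n m q₁ q₂ Φ xb ub) k) (seqWin m r₁ r₂ Δy k))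
    (k : ℤ) :
    HasDerivAt
      (fun s : ℝ => F k (seqWin m r₁ r₂ (fun j => refOut n m q₁ q₂ Φ xb ub j + s • Δy j) k))
      (Δx k, Δu k) 0 := by
  rw [hΔ k]
  exact (h.hasFDerivAt_parameterization k).comp_hasDerivAt_of_eq (0 : ℝ)
    (hasDerivAt_seqWin_refOut_add_smul Φ xb ub r₁ r₂ Δy k) (by simp)

/-- Linearization of (F2). -/
lemma isLinTrajectory_fderiv_parameterization (h : FlatData n m f xb ub q₁ q₂ r₁ r₂ U V Φ F)
    (hf : ∀ k, Differentiable ℝ (Function.uncurry (f k)))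
    {Δy : ℤ → Vec m} {Δx : ℤ → Vec n} {Δu : ℤ → Vec m}
    (hΔ : ∀ k, (Δx k, Δu k) =
      fderiv ℝ (F k) (seqWin m r₁ r₂ (refOut n m q₁ q₂ Φ xb ub) k) (seqWin m r₁ r₂ Δy k)) :
    IsLinTrajectory n m f xb ub Δx Δu := by
  intro k
  rw [← fderiv_uncurry_apply (hf k _)]
  have hD := (hf k (xb k, ub k)).hasFDerivAt.comp_hasDerivAt_of_eq (0 : ℝ)
    (h.hasDerivAt_parameterization hΔ k) (by simpa using (h.parameterization_refOut k).symm)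
  have hL := (hasFDerivAt_fst (𝕜 := ℝ)).comp_hasDerivAt (0 : ℝ)
    (h.hasDerivAt_parameterization hΔ (k + 1))
  refine hL.unique (hD.congr_of_eventuallyEq ?_)
  filter_upwards [h.eventually_seqWin_mem Δy k, h.eventually_seqWin_mem Δy (k + 1)] with s h₁ h₂
  exact h.F2 k _ h₁ h₂

/-- Linearization of (F3). -/
lemma fderiv_flatOutput_parameterization (h : FlatData n m f xb ub q₁ q₂ r₁ r₂ U V Φ F)
    {Δy : ℤ → Vec m} {Δx : ℤ → Vec n} {Δu : ℤ → Vec m}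
    (hΔ : ∀ k, (Δx k, Δu k) =
      fderiv ℝ (F k) (seqWin m r₁ r₂ (refOut n m q₁ q₂ Φ xb ub) k) (seqWin m r₁ r₂ Δy k))
    (k : ℤ) :
    fderiv ℝ (Φ k) (pairWin n m q₁ q₂ xb ub k) (pairWin n m q₁ q₂ Δx Δu k) = Δy k := by
  let y : ℝ → ℤ → Vec m := fun s j => refOut n m q₁ q₂ Φ xb ub j + s • Δy j
  have hW : HasDerivAt (fun s => pairWin n m q₁ q₂
      (fun j => (F j (seqWin m r₁ r₂ (y s) j)).1) (fun j => (F j (seqWin m r₁ r₂ (y s) j)).2) k)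
      (pairWin n m q₁ q₂ Δx Δu k) 0 :=
    hasDerivAt_pairWin fun j _ _ => h.hasDerivAt_parameterization hΔ j
  have hW0 : pairWin n m q₁ q₂ (fun j => (F j (seqWin m r₁ r₂ (y 0) j)).1)
      (fun j => (F j (seqWin m r₁ r₂ (y 0) j)).2) k = pairWin n m q₁ q₂ xb ub k := by
    simp [y, h.parameterization_refOut]
  have hΦ := (h.hasFDerivAt_flatOutput k).comp_hasDerivAt_of_eq (0 : ℝ) hW hW0.symm
  have hevV : ∀ᶠ s in 𝓝 (0 : ℝ), ∀ j, k - q₁ ≤ j → j ≤ k + q₂ → seqWin m r₁ r₂ (y s) j ∈ V :=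
    eventually_forall_int_Icc fun j _ _ => h.eventually_seqWin_mem Δy j
  have hevU := hW.continuousAt.eventually_mem
    (h.openU.mem_nhds (by rw [hW0]; exact h.memU k))
  refine hΦ.unique ((hasDerivAt_add_smul (refOut n m q₁ q₂ Φ xb ub k) (Δy k)).congr_of_eventuallyEq
    ?_)
  filter_upwards [hevU, hevV] with s hsU hsV
  exact h.F3 k (y s) hsV hsU

end FlatData

/-- The linearization of a flat discrete-time system along a
trajectory is again flat, with flat output the linearization of `Φ` and
parameterization the linearization of `F`. -/
theorem linearization_of_flat_is_flat
    (n m : ℕ) (f : ℤ → Vec n → Vec m → Vec n)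
    (hf : ∀ k : ℤ, ContDiff ℝ (⊤ : ℕ∞) (Function.uncurry (f k)))
    (xb : ℤ → Vec n) (ub : ℤ → Vec m)
    (q₁ q₂ r₁ r₂ : ℕ)
    (U : Set (Fin (q₁ + q₂ + 1) → Vec n × Vec m))
    (V : Set (Fin (r₁ + r₂ + 1) → Vec m))
    (Φ : ℤ → (Fin (q₁ + q₂ + 1) → Vec n × Vec m) → Vec m)
    (F : ℤ → (Fin (r₁ + r₂ + 1) → Vec m) → Vec n × Vec m)
    (hdata : FlatData n m f xb ub q₁ q₂ r₁ r₂ U V Φ F) :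
    -- (a): for every trajectory of the linearized system, the linearized flat
    -- output `Δy(k) = dΦ_k[W_k(Δx,Δu)]` satisfies
    -- `(Δx(k),Δu(k)) = dF_k[W_k(Δy)]`.
    (∀ (Δx : ℤ → Vec n) (Δu : ℤ → Vec m),
      IsLinTrajectory n m f xb ub Δx Δu →
      ∀ Δy : ℤ → Vec m,
        (∀ k : ℤ, Δy k =
          fderiv ℝ (Φ k) (pairWin n m q₁ q₂ xb ub k)
            (pairWin n m q₁ q₂ Δx Δu k)) →
        ∀ k : ℤ, (Δx k, Δu k) =
          fderiv ℝ (F k) (seqWin m r₁ r₂ (refOut n m q₁ q₂ Φ xb ub) k)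
            (seqWin m r₁ r₂ Δy k)) ∧
    -- (b): every sequence `Δy` generates via `dF` a trajectory of the
    -- linearized system, on which the linearized flat output equals `Δy`.
    (∀ (Δy : ℤ → Vec m) (Δx : ℤ → Vec n) (Δu : ℤ → Vec m),
      (∀ k : ℤ, (Δx k, Δu k) =
        fderiv ℝ (F k) (seqWin m r₁ r₂ (refOut n m q₁ q₂ Φ xb ub) k)
          (seqWin m r₁ r₂ Δy k)) →
      IsLinTrajectory n m f xb ub Δx Δu ∧
      ∀ k : ℤ, fderiv ℝ (Φ k) (pairWin n m q₁ q₂ xb ub k)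
          (pairWin n m q₁ q₂ Δx Δu k) = Δy k) := by
  have hd : ∀ k, Differentiable ℝ (Function.uncurry (f k)) := fun k =>
    (hf k).differentiable (by simp)
  exact ⟨fun _ _ hΔ _ hy k => hdata.fderiv_parameterization_flatOutput hd hΔ hy k,
    fun _ _ _ hΔ => ⟨hdata.isLinTrajectory_fderiv_parameterization hd hΔ,
      hdata.fderiv_flatOutput_parameterization hΔ⟩⟩

end
end

section
/- Suppose F parameterizes the trajectories of f by arbitrary sequences. Then the parameterization satisfies the system equations identically: for every k ∈ ℤ and every tuple (y_0, y_1, …, y_{R+1}) ∈ (ℝ^m)^{R+2}, F_x(k+1, y_1, …, y_{R+1}) = f(k, F_x(k, y_0, …, y_R), F_u(k, y_0, …, y_R)). -/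
noncomputable section

/-- The forward window `(y(k), y(k+1), …, y(k+R))` of a sequence. -/
def fwdWin (m R : ℕ) (y : ℤ → Vec m) (k : ℤ) : Fin (R + 1) → Vec m :=
  fun i => y (k + (i : ℕ))

/-- `F = (F_x, F_u)` parameterizes the trajectories of `f` by arbitrary
sequences: `F(k,·)` is `C^∞` for every `k`, and for every sequence
`y : ℤ → ℝ^m` the pair `x(k) = F_x(k, y(k),…,y(k+R))`,
`u(k) = F_u(k, y(k),…,y(k+R))` is a trajectory of `f`. -/
def Parameterizes (n m R : ℕ) (f : ℤ → Vec n → Vec m → Vec n)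
    (F : ℤ → (Fin (R + 1) → Vec m) → Vec n × Vec m) : Prop :=
  (∀ k : ℤ, ContDiff ℝ (⊤ : ℕ∞) (F k)) ∧
  ∀ y : ℤ → Vec m,
    IsTrajectory n m f (fun k => (F k (fwdWin m R y k)).1)
      (fun k => (F k (fwdWin m R y k)).2)


/-- A parameterization satisfies the system equations
identically: for every `k` and every tuple `(y₀,…,y_{R+1})`,
`F_x(k+1, y₁,…,y_{R+1}) = f(k, F_x(k, y₀,…,y_R), F_u(k, y₀,…,y_R))`. -/
theorem parameterization_satisfies_system_identically
    (n m R : ℕ) (f : ℤ → Vec n → Vec m → Vec n)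
    (hf : ∀ k : ℤ, ContDiff ℝ (⊤ : ℕ∞) (Function.uncurry (f k)))
    (F : ℤ → (Fin (R + 1) → Vec m) → Vec n × Vec m)
    (hF : Parameterizes n m R f F) :
    ∀ (k : ℤ) (y : Fin (R + 2) → Vec m),
      (F (k + 1) (fun i : Fin (R + 1) => y i.succ)).1 =
        f k (F k (fun i : Fin (R + 1) => y i.castSucc)).1
          (F k (fun i : Fin (R + 1) => y i.castSucc)).2 := by
  intro k y
  let z : ℤ → Vec m := fun j => y (Fin.ofNat (R + 2) (j - k).toNat)
  have hz (j : ℤ) (i : Fin (R + 2)) (hj : j = k + (i : ℕ)) : z j = y i := by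
    simp [z, hj]
  have h₀ : fwdWin m R z k = fun i : Fin (R + 1) => y i.castSucc :=
    funext fun i => hz _ _ (by simp)
  have h₁ : fwdWin m R z (k + 1) = fun i : Fin (R + 1) => y i.succ :=
    funext fun i => hz _ _ (by push_cast [Fin.val_succ]; ring)
  simpa only [h₀, h₁] using hF.2 z k

end
end

section
/- Suppose F parameterizes the trajectories of f by arbitrary sequences. Then the state part of the parameterization does not depend on the highest forward shift of the flat output: for every k ∈ ℤ and every point of (ℝ^m)^{R+1}, the partial derivative of F_x(k, y_0, …, y_R) with respect to the last block y_R vanishes. -/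
noncomputable section

/-- The state part of a parameterization at time `k` is determined by the window at time `k - 1`,
hence is unchanged when the last block is updated. -/
theorem Parameterizes.fst_update_last {n m R : ℕ} {f : ℤ → Vec n → Vec m → Vec n}
    {F : ℤ → (Fin (R + 1) → Vec m) → Vec n × Vec m} (hF : Parameterizes n m R f F)
    (k : ℤ) (p : Fin (R + 1) → Vec m) (w : Vec m) :
    (F k (Function.update p (Fin.last R) w)).1 = (F k p).1 := by
  let y (q : Fin (R + 1) → Vec m) : ℤ → Vec m := fun j =>
    if j < k then 0 else q (Fin.ofNat (R + 1) (j - k).toNat)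
  have fwdWin_y (q : Fin (R + 1) → Vec m) : fwdWin m R (y q) k = q := by
    funext i
    simp [fwdWin, y]
  have step (q : Fin (R + 1) → Vec m) :
      (F k q).1 = f (k - 1) (F (k - 1) (fwdWin m R (y q) (k - 1))).1
        (F (k - 1) (fwdWin m R (y q) (k - 1))).2 := by
    have h := hF.2 (y q) (k - 1)
    simpa only [sub_add_cancel, fwdWin_y] using h
  have prev : fwdWin m R (y (Function.update p (Fin.last R) w)) (k - 1)
      = fwdWin m R (y p) (k - 1) := by
    funext i
    simp only [fwdWin, y]
    split_ifs with hlt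
    · rfl
    rw [Function.update_of_ne]
    intro h
    have h' := congrArg Fin.val h
    have hi := i.isLt
    rw [Fin.val_ofNat, Nat.mod_eq_of_lt (by omega), Fin.val_last] at h'
    omega
  rw [step, step, prev]

/-- The state part of a parameterization does not depend on
the highest forward shift: the partial derivative of `F_x(k, y₀,…,y_R)` with
respect to the last block `y_R` vanishes everywhere. -/
theorem state_parameterization_independent_of_highest_shift
    (n m R : ℕ) (f : ℤ → Vec n → Vec m → Vec n)
    (hf : ∀ k : ℤ, ContDiff ℝ (⊤ : ℕ∞) (Function.uncurry (f k)))
    (F : ℤ → (Fin (R + 1) → Vec m) → Vec n × Vec m)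
    (hF : Parameterizes n m R f F) :
    ∀ (k : ℤ) (p : Fin (R + 1) → Vec m),
      fderiv ℝ (fun w : Vec m => (F k (Function.update p (Fin.last R) w)).1)
        (p (Fin.last R)) = 0 := by
  intro k p
  simp only [hF.fst_update_last, fderiv_fun_const, Pi.zero_apply]

end
end

section
/- Let f be flat along a trajectory (x̄,ū) and submersive along (x̄,ū), with parameterization F : ℤ × V → ℝ^n × ℝ^m and reference flat-output trajectory ȳ. Then for every k ∈ ℤ the derivative of F(k,·) at the reference window W_k^{r₁,r₂}(ȳ) is a surjective linear map (ℝ^m)^{r₁+r₂+1} → ℝ^n × ℝ^m; i.e., the Jacobian of the parameterization with respect to the flat output and its shifts has rank n+m for all k. -/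
open Filter Topology

noncomputable section

/-- A map with surjective derivative at `a` has a local right inverse through `a`. -/
theorem ContDiffAt.exists_local_rightInverse {E G : Type*}
    [NormedAddCommGroup E] [NormedSpace ℝ E]
    [NormedAddCommGroup G] [NormedSpace ℝ G] [FiniteDimensional ℝ G]
    {g : E → G} {a : E} (hg : ContDiffAt ℝ 1 g a)
    (hs : Function.Surjective (fderiv ℝ g a)) :
    ∃ s : G → E, DifferentiableAt ℝ s (g a) ∧ s (g a) = a ∧ ∀ᶠ y in 𝓝 (g a), g (s y) = y := by
  have := FiniteDimensional.complete ℝ G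
  obtain ⟨R, hR⟩ := (fderiv ℝ g a).exists_rightInverse_of_surjective
    (LinearMap.range_eq_top.2 hs)
  have hgd : HasStrictFDerivAt g (fderiv ℝ g a) (a + R 0) := by
    simpa using hg.hasStrictFDerivAt one_ne_zero
  have hd : HasStrictFDerivAt (fun v : G => g (a + R v))
      ((ContinuousLinearEquiv.refl ℝ G : G ≃L[ℝ] G) : G →L[ℝ] G) 0 := by
    have h := HasStrictFDerivAt.comp (0 : G) (f := fun v => a + R v) hgd
      (R.hasStrictFDerivAt.const_add a)
    rw [hR] at h
    exact h
  have h0 : g (a + R 0) = g a := by simp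
  refine ⟨fun y => a + R (hd.localInverse _ _ _ y), ?_, ?_, ?_⟩
  · have h := hd.to_localInverse.hasFDerivAt.differentiableAt
    simp only [h0] at h
    exact (R.differentiableAt.comp _ h).const_add a
  · have h := hd.localInverse_apply_image
    simp only [h0] at h
    simp [h]
  · have h := hd.eventually_right_inverse
    simpa only [h0] using h

/-- Every state-input pair near `(xb k, ub k)` extends to a family of two-sided sequences,
differentiable at the reference, such that each system
equation holds near the reference. -/
theorem exists_trajectory_family {n m : ℕ} {f : ℤ → Vec n → Vec m → Vec n}
    (hf : ∀ k : ℤ, ContDiff ℝ (⊤ : ℕ∞) (Function.uncurry (f k)))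
    {xb : ℤ → Vec n} {ub : ℤ → Vec m} (htraj : IsTrajectory n m f xb ub)
    (hsub : IsSubmersiveAlong n m f xb ub) (k : ℤ) :
    ∃ X : ℤ → Vec n × Vec m → Vec n × Vec m, X k = id ∧
      (∀ j, DifferentiableAt ℝ (X j) (xb k, ub k)) ∧
      (∀ j, X j (xb k, ub k) = (xb j, ub j)) ∧
      ∀ j, ∀ᶠ z in 𝓝 (xb k, ub k), (X (j + 1) z).1 = f j (X j z).1 (X j z).2 := by
  have hloc : ∀ j, ∃ s : Vec n → Vec n × Vec m, DifferentiableAt ℝ s (xb (j + 1)) ∧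
      s (xb (j + 1)) = (xb j, ub j) ∧
      ∀ᶠ x in 𝓝 (xb (j + 1)), f j (s x).1 (s x).2 = x := by
    intro j
    have h := ContDiffAt.exists_local_rightInverse
      (((hf j).contDiffAt (x := (xb j, ub j))).of_le (by simp)) (hsub j)
    have e : Function.uncurry (f j) (xb j, ub j) = xb (j + 1) := (htraj j).symm
    rw [e] at h
    exact h
  choose s hsd hs0 hsr using hloc
  let X : ℤ → Vec n × Vec m → Vec n × Vec m := fun j =>
    Int.inductionOn' (motive := fun _ => Vec n × Vec m → Vec n × Vec m) j k id
      (fun i _ Y z => (f i (Y z).1 (Y z).2, ub (i + 1)))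
      (fun i _ Y z => s (i - 1) (Y z).1)
  have Xk : X k = id := Int.inductionOn'_self
  have Xs : ∀ i, k ≤ i → X (i + 1) = fun z => (f i (X i z).1 (X i z).2, ub (i + 1)) :=
    fun i hi => Int.inductionOn'_add_one hi
  have Xp : ∀ i, i ≤ k → X (i - 1) = fun z => s (i - 1) (X i z).1 :=
    fun i hi => Int.inductionOn'_sub_one hi
  have key : ∀ j, DifferentiableAt ℝ (X j) (xb k, ub k) ∧
      X j (xb k, ub k) = (xb j, ub j) := by
    intro j
    induction j using Int.inductionOn' (b := k) with
    | zero => rw [Xk]; exact ⟨differentiableAt_id, rfl⟩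
    | succ i hi ih =>
      rw [Xs i hi]
      refine ⟨?_, by simp [ih.2, htraj i]⟩
      have h1 : DifferentiableAt ℝ (Function.uncurry (f i)) (X i (xb k, ub k)) :=
        (hf i).differentiable (by simp) _
      exact (h1.comp _ ih.1).prodMk (differentiableAt_const _)
    | pred i hi ih =>
      rw [Xp i hi]
      have e := hs0 (i - 1)
      have d := hsd (i - 1)
      rw [sub_add_cancel] at e d
      refine ⟨?_, by simp [ih.2, e]⟩
      refine DifferentiableAt.comp (g := s (i - 1)) (f := fun z => (X i z).1) _ ?_ ih.1.fst
      simpa [ih.2] using d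
  refine ⟨X, Xk, fun j => (key j).1, fun j => (key j).2, fun j => ?_⟩
  rcases le_or_gt k j with hj | hj
  · rw [Xs j hj]
    exact Eventually.of_forall fun _ => rfl
  · have hX := Xp (j + 1) (by lia)
    rw [add_sub_cancel_right] at hX
    have hc : Tendsto (fun z => (X (j + 1) z).1) (𝓝 (xb k, ub k)) (𝓝 (xb (j + 1))) := by
      have h := (key (j + 1)).1.fst.continuousAt.tendsto
      simpa only [(key (j + 1)).2] using h
    filter_upwards [hc.eventually (hsr j)] with z hz
    rw [hX]
    exact hz.symm

/-- If `f` is flat and submersive along `(xb, ub)`, then for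
every `k` the derivative of the parameterization `F(k,·)` at the reference
window is surjective, i.e. its Jacobian has rank `n + m`. -/
theorem parameterization_jacobian_full_rank
    (n m : ℕ) (f : ℤ → Vec n → Vec m → Vec n)
    (hf : ∀ k : ℤ, ContDiff ℝ (⊤ : ℕ∞) (Function.uncurry (f k)))
    (xb : ℤ → Vec n) (ub : ℤ → Vec m)
    (q₁ q₂ r₁ r₂ : ℕ)
    (U : Set (Fin (q₁ + q₂ + 1) → Vec n × Vec m))
    (V : Set (Fin (r₁ + r₂ + 1) → Vec m))
    (Φ : ℤ → (Fin (q₁ + q₂ + 1) → Vec n × Vec m) → Vec m)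
    (F : ℤ → (Fin (r₁ + r₂ + 1) → Vec m) → Vec n × Vec m)
    (hdata : FlatData n m f xb ub q₁ q₂ r₁ r₂ U V Φ F)
    (hsub : IsSubmersiveAlong n m f xb ub) :
    ∀ k : ℤ, Function.Surjective
      ⇑(fderiv ℝ (F k) (seqWin m r₁ r₂ (refOut n m q₁ q₂ Φ xb ub) k)) := by
  intro k
  obtain ⟨X, Xk, Xd, X0, Xf⟩ := exists_trajectory_family hf hdata.traj hsub k
  set z₀ : Vec n × Vec m := (xb k, ub k) with hz₀
  let W : ℤ → Vec n × Vec m → Fin (q₁ + q₂ + 1) → Vec n × Vec m := fun j z =>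
    pairWin n m q₁ q₂ (fun i => (X i z).1) (fun i => (X i z).2) j
  have W0 : ∀ j, W j z₀ = pairWin n m q₁ q₂ xb ub j := by
    intro j
    funext i
    simp [W, pairWin, X0]
  have Wd : ∀ j, DifferentiableAt ℝ (W j) z₀ := fun j =>
    differentiableAt_pi.2 fun i => Xd (j - q₁ + (i : ℕ))
  have WU : ∀ j, ∀ᶠ z in 𝓝 z₀, W j z ∈ U := fun j =>
    (Wd j).continuousAt.eventually_mem (hdata.openU.mem_nhds (by rw [W0]; exact hdata.memU j))
  let G : Vec n × Vec m → Fin (r₁ + r₂ + 1) → Vec m := fun z =>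
    seqWin m r₁ r₂ (fun j => Φ j (W j z)) k
  have G0 : G z₀ = seqWin m r₁ r₂ (refOut n m q₁ q₂ Φ xb ub) k := by
    simp only [G, W0]
    rfl
  have Gd : DifferentiableAt ℝ G z₀ := by
    refine differentiableAt_pi.2 fun i => ?_
    refine DifferentiableAt.comp (g := Φ (k - r₁ + (i : ℕ))) z₀ ?_ (Wd _)
    rw [W0]
    exact ((hdata.smoothPhi _).contDiffAt (hdata.openU.mem_nhds (hdata.memU _))).differentiableAt
      (by simp)
  have GV : V ∈ 𝓝 (G z₀) := hdata.openV.mem_nhds (by rw [G0]; exact hdata.memV k)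
  have Fd : DifferentiableAt ℝ (F k) (G z₀) :=
    ((hdata.smoothF k).contDiffAt GV).differentiableAt (by simp)
  have hFG : F k ∘ G =ᶠ[𝓝 z₀] id := by
    have h1 : ∀ᶠ z in 𝓝 z₀, ∀ j ∈ Set.Ico (k - r₁ - q₁) (k + r₂ + q₂),
        (X (j + 1) z).1 = f j (X j z).1 (X j z).2 :=
      (eventually_all_finite (Set.finite_Ico _ _)).2 fun j _ => Xf j
    have h2 : ∀ᶠ z in 𝓝 z₀, ∀ j ∈ Set.Icc (k - r₁ : ℤ) (k + r₂), W j z ∈ U :=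
      (eventually_all_finite (Set.finite_Icc _ _)).2 fun j _ => WU j
    filter_upwards [h1, h2, Gd.continuousAt.eventually_mem GV] with z hz1 hz2 hz3
    have h := hdata.F4 k (fun i => (X i z).1) (fun i => (X i z).2)
      (fun j ha hb => hz1 j ⟨ha, hb⟩) (fun j ha hb => hz2 j ⟨ha, hb⟩) hz3
    simpa [Xk] using h.symm
  have hcomp : (fderiv ℝ (F k) (G z₀)).comp (fderiv ℝ G z₀) = ContinuousLinearMap.id ℝ _ := by
    rw [← fderiv_comp z₀ Fd Gd, hFG.fderiv_eq, fderiv_id]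
  rw [← G0]
  exact fun v => ⟨fderiv ℝ G z₀ v, congrArg (fun L => L v) hcomp⟩

end
end

section
/- Let f be flat along a trajectory (x̄,ū) and submersive along (x̄,ū), with parameterization F = (F_x,F_u) : ℤ × V → ℝ^n × ℝ^m and reference flat-output trajectory ȳ. Then for every k ∈ ℤ the derivative of the state part F_x(k,·) at the reference window W_k^{r₁,r₂}(ȳ) is a surjective linear map (ℝ^m)^{r₁+r₂+1} → ℝ^n; i.e., the Jacobian of F_x with respect to the flat output and its shifts has rank n for all k. -/
open Filter Topology

noncomputable section

section ControlledRecursion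

/-- A backward-solvable recursion can be steered to any prescribed value after `N` steps. -/
lemma exists_controlled_seq_eq {E G : Type*} [Nonempty G] (A : ℕ → E × G → E)
    (hA : ∀ i, Function.Surjective (A i)) (N : ℕ) (ξ : E) :
    ∃ (x : ℕ → E) (u : ℕ → G), x N = ξ ∧ ∀ i < N, x (i + 1) = A i (x i, u i) := by
  classical
  induction N generalizing ξ with
  | zero => exact ⟨fun _ => ξ, fun _ => Classical.arbitrary G, rfl, by simp⟩
  | succ N ih =>
    obtain ⟨⟨a, b⟩, hab⟩ := hA N ξ
    obtain ⟨x, u, hx, hrec⟩ := ih a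
    refine ⟨Function.update x (N + 1) ξ, Function.update u N b, by simp, fun i hi => ?_⟩
    rcases Nat.lt_succ_iff_lt_or_eq.mp hi with h | rfl
    · rw [Function.update_of_ne (by omega), Function.update_of_ne (by omega),
        Function.update_of_ne (by omega), hrec i h]
    · simp [hx, hab]

/-- The solution of `x (i + 1) = g i (x i, v i)` starting at `x₀`. -/
def controlledFlow {E G : Type*} (g : ℕ → E × G → E) (x₀ : E) (v : ℕ → G) : ℕ → E
  | 0 => x₀
  | i + 1 => g i (controlledFlow g x₀ v i, v i)

variable {E G : Type*} [NormedAddCommGroup E] [NormedSpace ℝ E]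
  [NormedAddCommGroup G] [NormedSpace ℝ G]

/-- The flow from `a 0 + s • x₀` under the input `b + s • v`. -/
def perturbedFlow (g : ℕ → E × G → E) (a : ℕ → E) (b : ℕ → G) (x₀ : E) (v : ℕ → G)
    (s : ℝ) : ℕ → E :=
  controlledFlow g (a 0 + s • x₀) (fun i => b i + s • v i)

variable {g : ℕ → E × G → E} {a : ℕ → E} {b : ℕ → G}

lemma perturbedFlow_zero (ha : ∀ i, a (i + 1) = g i (a i, b i)) (x₀ : E) (v : ℕ → G) (i : ℕ) :
    perturbedFlow g a b x₀ v 0 i = a i := by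
  induction i with
  | zero => simp [perturbedFlow, controlledFlow]
  | succ i ih =>
    change g i (perturbedFlow g a b x₀ v 0 i, b i + (0 : ℝ) • v i) = a (i + 1)
    rw [ih, zero_smul, add_zero, ha i]

lemma hasDerivAt_add_smul_s6 (b v : G) : HasDerivAt (fun s : ℝ => b + s • v) v 0 := by
  simpa using ((hasDerivAt_id (0 : ℝ)).smul_const v).const_add b

lemma hasDerivAt_perturbedFlow_succ (ha : ∀ i, a (i + 1) = g i (a i, b i))
    (hg : ∀ i, DifferentiableAt ℝ (g i) (a i, b i)) {x₀ : E} {v : ℕ → G} {i : ℕ} {w : E}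
    (hw : HasDerivAt (fun s => perturbedFlow g a b x₀ v s i) w 0) :
    HasDerivAt (fun s => perturbedFlow g a b x₀ v s (i + 1))
      (fderiv ℝ (g i) (a i, b i) (w, v i)) 0 := by
  refine HasFDerivAt.comp_hasDerivAt_of_eq (0 : ℝ) (hg i).hasFDerivAt
    (hw.prodMk (hasDerivAt_add_smul_s6 (b i) (v i))) ?_
  change (a i, b i) = (perturbedFlow g a b x₀ v 0 i, b i + (0 : ℝ) • v i)
  rw [perturbedFlow_zero ha, zero_smul, add_zero]

lemma differentiableAt_perturbedFlow (ha : ∀ i, a (i + 1) = g i (a i, b i))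
    (hg : ∀ i, DifferentiableAt ℝ (g i) (a i, b i)) (x₀ : E) (v : ℕ → G) (i : ℕ) :
    DifferentiableAt ℝ (fun s => perturbedFlow g a b x₀ v s i) 0 := by
  induction i with
  | zero => exact (hasDerivAt_add_smul_s6 (a 0) x₀).differentiableAt
  | succ i ih => exact (hasDerivAt_perturbedFlow_succ ha hg ih.hasDerivAt).differentiableAt

lemma hasDerivAt_perturbedFlow (ha : ∀ i, a (i + 1) = g i (a i, b i))
    (hg : ∀ i, DifferentiableAt ℝ (g i) (a i, b i)) {x : ℕ → E} {v : ℕ → G} {N : ℕ}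
    (hx : ∀ i < N, x (i + 1) = fderiv ℝ (g i) (a i, b i) (x i, v i)) {i : ℕ} (hi : i ≤ N) :
    HasDerivAt (fun s => perturbedFlow g a b (x 0) v s i) (x i) 0 := by
  induction i with
  | zero => exact hasDerivAt_add_smul_s6 (a 0) (x 0)
  | succ i ih =>
    rw [hx i (by omega)]
    exact hasDerivAt_perturbedFlow_succ ha hg (ih (by omega))

end ControlledRecursion

/-- Every tangent vector at `xb k` is the velocity at time `k` of a differentiable family of
solutions on `[k - N, ∞)` through the reference trajectory. -/
lemma exists_solution_family {n m : ℕ} {f : ℤ → Vec n → Vec m → Vec n}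
    (hf : ∀ k : ℤ, ContDiff ℝ (⊤ : ℕ∞) (Function.uncurry (f k)))
    {xb : ℤ → Vec n} {ub : ℤ → Vec m} (htraj : IsTrajectory n m f xb ub)
    (hsub : IsSubmersiveAlong n m f xb ub) (N : ℕ) (k : ℤ) (ξ : Vec n) :
    ∃ (x : ℝ → ℤ → Vec n) (u : ℝ → ℤ → Vec m),
      (∀ s, ∀ j ≥ k - N, x s (j + 1) = f j (x s j) (u s j)) ∧
      (∀ j ≥ k - N, x 0 j = xb j) ∧ (∀ j, u 0 j = ub j) ∧
      (∀ j, DifferentiableAt ℝ (fun s => x s j) 0) ∧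
      (∀ j, DifferentiableAt ℝ (fun s => u s j) 0) ∧
      HasDerivAt (fun s => x s k) ξ 0 := by
  set K : ℤ := k - N with hK
  let g : ℕ → Vec n × Vec m → Vec n := fun i => Function.uncurry (f (K + i))
  let a : ℕ → Vec n := fun i => xb (K + i)
  let b : ℕ → Vec m := fun i => ub (K + i)
  have ha : ∀ i, a (i + 1) = g i (a i, b i) := fun i => by
    have h := htraj (K + i)
    simpa [a, b, g, add_assoc] using h
  have hg : ∀ i, DifferentiableAt ℝ (g i) (a i, b i) := fun i =>
    (hf (K + i)).differentiable (by simp) _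
  obtain ⟨Δx, Δu, hN, hrec⟩ := exists_controlled_seq_eq
    (fun i => fderiv ℝ (g i) (a i, b i)) (fun i => hsub (K + i)) N ξ
  refine ⟨fun s j => perturbedFlow g a b (Δx 0) Δu s (j - K).toNat,
    fun s j => ub j + s • Δu (j - K).toNat, fun s j hj => ?_, fun j hj => ?_, fun j => by simp,
    fun j => differentiableAt_perturbedFlow ha hg _ _ _,
    fun j => (hasDerivAt_add_smul_s6 _ _).differentiableAt, ?_⟩
  · obtain ⟨i, rfl⟩ := Int.le.dest hj
    have h₁ : (K + i + 1 - K).toNat = i + 1 := by omega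
    have h₂ : (K + i - K).toNat = i := by omega
    simp only [h₁, h₂]
    rfl
  · obtain ⟨i, rfl⟩ := Int.le.dest hj
    have h : (K + i - K).toNat = i := by omega
    simp only [h, perturbedFlow_zero ha, a]
  · have h : (k - K).toNat = N := by omega
    simpa only [h, hN] using hasDerivAt_perturbedFlow ha hg hrec le_rfl

/-- If `f` is flat and submersive along `(xb, ub)`, then for
every `k` the derivative of the state part `F_x(k,·)` of the parameterization
at the reference window is surjective, i.e. its Jacobian has rank `n`. -/
theorem state_parameterization_jacobian_full_rank
    (n m : ℕ) (f : ℤ → Vec n → Vec m → Vec n)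
    (hf : ∀ k : ℤ, ContDiff ℝ (⊤ : ℕ∞) (Function.uncurry (f k)))
    (xb : ℤ → Vec n) (ub : ℤ → Vec m)
    (q₁ q₂ r₁ r₂ : ℕ)
    (U : Set (Fin (q₁ + q₂ + 1) → Vec n × Vec m))
    (V : Set (Fin (r₁ + r₂ + 1) → Vec m))
    (Φ : ℤ → (Fin (q₁ + q₂ + 1) → Vec n × Vec m) → Vec m)
    (F : ℤ → (Fin (r₁ + r₂ + 1) → Vec m) → Vec n × Vec m)
    (hdata : FlatData n m f xb ub q₁ q₂ r₁ r₂ U V Φ F)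
    (hsub : IsSubmersiveAlong n m f xb ub) :
    ∀ k : ℤ, Function.Surjective
      ⇑(fderiv ℝ (fun p => (F k p).1)
        (seqWin m r₁ r₂ (refOut n m q₁ q₂ Φ xb ub) k)) := by
  intro k ξ
  obtain ⟨x, u, hsol, hx0, hu0, hdx, hdu, hξ⟩ :=
    exists_solution_family hf hdata.traj hsub (r₁ + q₁) k ξ
  have hwin0 : ∀ j ≥ k - r₁, pairWin n m q₁ q₂ (x 0) (u 0) j = pairWin n m q₁ q₂ xb ub j := by
    intro j hj
    funext i
    simp only [pairWin]
    rw [hx0 _ (by push_cast; omega), hu0]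
  have hwin : ∀ j, DifferentiableAt ℝ (fun s => pairWin n m q₁ q₂ (x s) (u s) j) 0 := fun j =>
    differentiableAt_pi.2 fun i => (hdx _).prodMk (hdu _)
  let w : ℝ → Fin (r₁ + r₂ + 1) → Vec m := fun s =>
    seqWin m r₁ r₂ (fun j => Φ j (pairWin n m q₁ q₂ (x s) (u s) j)) k
  have hw0 : w 0 = seqWin m r₁ r₂ (refOut n m q₁ q₂ Φ xb ub) k := by
    funext i
    simp only [w, seqWin, refOut]
    rw [hwin0 _ (by omega)]
  have hw : DifferentiableAt ℝ w 0 := by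
    refine differentiableAt_pi.2 fun i => ?_
    have hj : k - r₁ + ((i : ℕ) : ℤ) ≥ k - r₁ := by omega
    have hΦ : DifferentiableAt ℝ (Φ (k - r₁ + ((i : ℕ) : ℤ)))
        (pairWin n m q₁ q₂ (x 0) (u 0) (k - r₁ + ((i : ℕ) : ℤ))) := by
      rw [hwin0 _ hj]
      exact ((hdata.smoothPhi _).contDiffAt
        (hdata.openU.mem_nhds (hdata.memU _))).differentiableAt (by simp)
    exact hΦ.comp (0 : ℝ) (hwin _)
  have hV : seqWin m r₁ r₂ (refOut n m q₁ q₂ Φ xb ub) k ∈ V := hdata.memV k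
  have hF : DifferentiableAt ℝ (fun p => (F k p).1)
      (seqWin m r₁ r₂ (refOut n m q₁ q₂ Φ xb ub) k) :=
    (((hdata.smoothF k).contDiffAt (hdata.openV.mem_nhds hV)).differentiableAt (by simp)).fst
  have hevU : ∀ᶠ s in 𝓝 (0 : ℝ), ∀ j ∈ Set.Icc (k - r₁) (k + r₂),
      pairWin n m q₁ q₂ (x s) (u s) j ∈ U := by
    refine (Filter.eventually_all_finite (Set.finite_Icc _ _)).2 fun j hj => ?_
    refine (hwin j).continuousAt.eventually_mem (hdata.openU.mem_nhds ?_)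
    rw [hwin0 j hj.1]
    exact hdata.memU j
  have hevV : ∀ᶠ s in 𝓝 (0 : ℝ), w s ∈ V :=
    hw.continuousAt.eventually_mem (hdata.openV.mem_nhds (hw0 ▸ hV))
  have hev : (fun s => x s k) =ᶠ[𝓝 0] fun s => (F k (w s)).1 := by
    filter_upwards [hevU, hevV] with s hsU hsV
    exact congrArg Prod.fst (hdata.F4 k (x s) (u s)
      (fun j hj _ => hsol s j (by push_cast; omega)) (fun j h1 h2 => hsU j ⟨h1, h2⟩) hsV)
  exact ⟨deriv w 0, (hF.hasFDerivAt.comp_hasDerivAt_of_eq (0 : ℝ) hw.hasDerivAt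
    hw0.symm).unique (hξ.congr_of_eventuallyEq hev.symm)⟩

end
end

section
/- Every trajectory of the system is uniquely determined in forward and backward direction by the current state, the future inputs, and the past values of g: let g : ℤ × ℝ^n × ℝ^m → ℝ^m be such that (x,u) ↦ (f(k,x,u), g(k,x,u)) is a bijection of ℝ^n × ℝ^m onto itself for every k ∈ ℤ. Then for every k₀ ∈ ℤ, every x₀ ∈ ℝ^n, every function v : {k ∈ ℤ : k ≥ k₀} → ℝ^m, and every function ζ : {k ∈ ℤ : k < k₀} → ℝ^m, there exists a unique trajectory (x,u) of f such that x(k₀) = x₀, u(k) = v(k) for all k ≥ k₀, and g(k, x(k), u(k)) = ζ(k) for all k < k₀. -/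
noncomputable section

/-- A sequence indexed by `ℤ` is determined by its value at `k₀`, a recursion for the later terms
and a backward recursion for the earlier ones. -/
theorem Int.existsUnique_seq_of_forward_backward {X : Type*} (k₀ : ℤ) (x₀ : X)
    (F B : ℤ → X → X) :
    ∃! x : ℤ → X, x k₀ = x₀ ∧ (∀ k, k₀ ≤ k → x (k + 1) = F k (x k)) ∧
      ∀ k, k < k₀ → x k = B k (x (k + 1)) := by
  refine ⟨fun k => Int.inductionOn' (motive := fun _ => X) k k₀ x₀ (fun k _ y => F k y)
    (fun k _ y => B (k - 1) y), ⟨?_, ?_, ?_⟩, ?_⟩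
  · exact Int.inductionOn'_self ..
  · intro k hk
    exact Int.inductionOn'_add_one hk
  · intro k hk
    have h := Int.inductionOn'_sub_one (motive := fun _ => X) (zero := x₀)
      (succ := fun k _ y => F k y) (pred := fun k _ y => B (k - 1) y) (Int.add_one_le_of_lt hk)
    simpa only [add_sub_cancel_right] using h
  · rintro y ⟨h₀, hF, hB⟩
    funext k
    induction k using Int.inductionOn' (b := k₀) with
    | zero => rw [h₀, Int.inductionOn'_self]
    | succ k hk ih => rw [hF k hk, ih, Int.inductionOn'_add_one hk]
    | pred k hk ih =>
      rw [hB (k - 1) (by omega), sub_add_cancel, ih, Int.inductionOn'_sub_one hk]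

/-- Every trajectory of the system is uniquely determined in
forward and backward direction by the current state, the future inputs, and
the past values of `g`: if `(x,u) ↦ (f(k,x,u), g(k,x,u))` is a bijection for
every `k`, then for all `k₀`, `x₀`, prescribed future inputs `v` and
prescribed past values `ζ` of `g`, there is a unique trajectory `(x,u)` of `f`
with `x(k₀) = x₀`, `u(k) = v(k)` for `k ≥ k₀`, and `g(k,x(k),u(k)) = ζ(k)`
for `k < k₀`. -/
theorem trajectory_determined_by_state_inputs_and_past
    (n m : ℕ) (f : ℤ → Vec n → Vec m → Vec n)
    (hf : ∀ k : ℤ, ContDiff ℝ (⊤ : ℕ∞) (Function.uncurry (f k)))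
    (g : ℤ → Vec n → Vec m → Vec m)
    (hbij : ∀ k : ℤ, Function.Bijective
      (fun p : Vec n × Vec m => (f k p.1 p.2, g k p.1 p.2)))
    (k₀ : ℤ) (x₀ : Vec n) (v : ℤ → Vec m) (ζ : ℤ → Vec m) :
    ∃! xu : (ℤ → Vec n) × (ℤ → Vec m),
      IsTrajectory n m f xu.1 xu.2 ∧
      xu.1 k₀ = x₀ ∧
      (∀ k : ℤ, k₀ ≤ k → xu.2 k = v k) ∧
      (∀ k : ℤ, k < k₀ → g k (xu.1 k) (xu.2 k) = ζ k) := by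
  choose φ hφ using fun k => (hbij k).surjective
  have hstate (k : ℤ) (p : Vec n × Vec m) : f k (φ k p).1 (φ k p).2 = p.1 :=
    congrArg Prod.fst (hφ k p)
  have hout (k : ℤ) (p : Vec n × Vec m) : g k (φ k p).1 (φ k p).2 = p.2 :=
    congrArg Prod.snd (hφ k p)
  have hinv (k : ℤ) (a : Vec n) (b : Vec m) : φ k (f k a b, g k a b) = (a, b) :=
    (hbij k).injective (hφ k _)
  obtain ⟨x, ⟨h₀, hF, hB⟩, huniq⟩ := Int.existsUnique_seq_of_forward_backward k₀ x₀
    (fun k y => f k y (v k)) (fun k y => (φ k (y, ζ k)).1)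
  refine ⟨(x, fun k => if k₀ ≤ k then v k else (φ k (x (k + 1), ζ k)).2), ⟨?_, h₀, ?_, ?_⟩, ?_⟩
  · intro k
    by_cases hk : k₀ ≤ k
    · simpa only [if_pos hk] using hF k hk
    · simp only [if_neg hk]
      rw [hB k (not_le.mp hk), hstate]
  · intro k hk
    exact if_pos hk
  · intro k hk
    simp only [if_neg (not_le.mpr hk)]
    rw [hB k hk, hout]
  · rintro ⟨y, u⟩ ⟨htraj, hy₀, hv, hζ⟩
    dsimp only at htraj hy₀ hv hζ
    have hpast (k : ℤ) (hk : k < k₀) : φ k (y (k + 1), ζ k) = (y k, u k) := by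
      rw [htraj k, ← hζ k hk, hinv]
    obtain rfl : y = x := huniq y ⟨hy₀, fun k hk => by rw [htraj k, hv k hk],
      fun k hk => by simp only [hpast k hk]⟩
    refine Prod.ext rfl (funext fun k => ?_)
    by_cases hk : k₀ ≤ k
    · simp only [if_pos hk, hv k hk]
    · simp only [if_neg hk, hpast k (not_le.mp hk)]

end
end

section
/- Consider the system x¹(k+1) = x¹(k) + u¹(k), x²(k+1) = x²(k) + u²(k), x³(k+1) = x³(k) + u¹(k)u²(k), with state in ℝ³ and input in ℝ². For a trajectory (x,u) define y(k) = (y¹(k), y²(k)) := (x¹(k−1), x³(k) − x²(k)(x¹(k) − x¹(k−1))), and set D(k) := y¹(k) − 2y¹(k+1) + y¹(k+2). Then: (a) for every trajectory (x,u) and every k ∈ ℤ with D(k) ≠ 0, x¹(k) = y¹(k+1), x²(k) = (y²(k) − y²(k+1))/D(k), x³(k) = (y¹(k)y²(k+1) − y¹(k+1)(y²(k) + y²(k+1)) + y¹(k+2)y²(k))/D(k), u¹(k) = y¹(k+2) − y¹(k+1), and, if additionally D(k+1) ≠ 0, u²(k) = [y¹(k)(y²(k+1) − y²(k+2)) + y¹(k+1)(−y²(k)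 − y²(k+1) + 2y²(k+2)) + y¹(k+2)(2y²(k) − y²(k+1) − y²(k+2)) + y¹(k+3)(−y²(k) + y²(k+1))] / [y¹(k)(y¹(k+1) − 2y¹(k+2) + y¹(k+3)) + y¹(k+1)(−2y¹(k+1) + 5y¹(k+2) − 2y¹(k+3)) + y¹(k+2)(−2y¹(k+2) + y¹(k+3))]. (b) Conversely, for every sequence y : ℤ → ℝ² with D(k) ≠ 0 for all k ∈ ℤ, the formulas in (a) define a trajectory (x,u) of the system which satisfies y¹(k) = x¹(k−1) and y²(k) = x³(k) − x²(k)(x¹(k) − x¹(k−1)) for all k. Hence y is a flat output of the system with parameterization (a). -/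
noncomputable section

/-- The increment of the ratio of a first difference to a second difference, over the common
denominator written out as a polynomial. -/
theorem div_second_diff_sub_div_second_diff {a b c d p q r : ℝ}
    (h : a - 2 * b + c ≠ 0) (h' : b - 2 * c + d ≠ 0) :
    (q - r) / (b - 2 * c + d) - (p - q) / (a - 2 * b + c) =
      (a * (q - r) + b * (-p - q + 2 * r) + c * (2 * p - q - r) + d * (-p + q)) /
        (a * (b - 2 * c + d) + b * (-2 * b + 5 * c - 2 * d) + c * (-2 * c + d)) := by
  rw [div_sub_div _ _ h' h]
  congr 1 <;> ring

/-- For the system `x¹⁺ = x¹ + u¹`, `x²⁺ = x² + u²`,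
`x³⁺ = x³ + u¹u²`, the output `y(k) = (x¹(k-1), x³(k) - x²(k)(x¹(k) - x¹(k-1)))` is
a flat output: (a) along every trajectory the states and inputs are recovered
from `y` by the stated rational formulas wherever `D(k) = y¹(k) - 2y¹(k+1) +
y¹(k+2)` does not vanish, and (b) every sequence `y` with `D(k) ≠ 0` for all
`k` generates a trajectory via these formulas, on which the output recovers
`y`. -/
theorem product_example_flat :
    -- (a)
    (∀ x1 x2 x3 u1 u2 : ℤ → ℝ,
      (∀ k : ℤ, x1 (k + 1) = x1 k + u1 k) →
      (∀ k : ℤ, x2 (k + 1) = x2 k + u2 k) →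
      (∀ k : ℤ, x3 (k + 1) = x3 k + u1 k * u2 k) →
      ∀ y1 y2 D : ℤ → ℝ,
        (∀ j : ℤ, y1 j = x1 (j - 1)) →
        (∀ j : ℤ, y2 j = x3 j - x2 j * (x1 j - x1 (j - 1))) →
        (∀ j : ℤ, D j = y1 j - 2 * y1 (j + 1) + y1 (j + 2)) →
        ∀ k : ℤ, D k ≠ 0 →
          x1 k = y1 (k + 1) ∧
          x2 k = (y2 k - y2 (k + 1)) / D k ∧
          x3 k = (y1 k * y2 (k + 1) - y1 (k + 1) * (y2 k + y2 (k + 1)) +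
              y1 (k + 2) * y2 k) / D k ∧
          u1 k = y1 (k + 2) - y1 (k + 1) ∧
          (D (k + 1) ≠ 0 →
            u2 k =
              (y1 k * (y2 (k + 1) - y2 (k + 2)) +
                y1 (k + 1) * (-y2 k - y2 (k + 1) + 2 * y2 (k + 2)) +
                y1 (k + 2) * (2 * y2 k - y2 (k + 1) - y2 (k + 2)) +
                y1 (k + 3) * (-y2 k + y2 (k + 1))) /
              (y1 k * (y1 (k + 1) - 2 * y1 (k + 2) + y1 (k + 3)) +
                y1 (k + 1) * (-2 * y1 (k + 1) + 5 * y1 (k + 2) - 2 * y1 (k + 3)) +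
                y1 (k + 2) * (-2 * y1 (k + 2) + y1 (k + 3))))) ∧
    -- (b)
    (∀ y1 y2 D : ℤ → ℝ,
      (∀ j : ℤ, D j = y1 j - 2 * y1 (j + 1) + y1 (j + 2)) →
      (∀ j : ℤ, D j ≠ 0) →
      ∀ x1 x2 x3 u1 u2 : ℤ → ℝ,
        (∀ k : ℤ, x1 k = y1 (k + 1)) →
        (∀ k : ℤ, x2 k = (y2 k - y2 (k + 1)) / D k) →
        (∀ k : ℤ, x3 k = (y1 k * y2 (k + 1) - y1 (k + 1) * (y2 k + y2 (k + 1)) +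
            y1 (k + 2) * y2 k) / D k) →
        (∀ k : ℤ, u1 k = y1 (k + 2) - y1 (k + 1)) →
        (∀ k : ℤ, u2 k =
            (y1 k * (y2 (k + 1) - y2 (k + 2)) +
              y1 (k + 1) * (-y2 k - y2 (k + 1) + 2 * y2 (k + 2)) +
              y1 (k + 2) * (2 * y2 k - y2 (k + 1) - y2 (k + 2)) +
              y1 (k + 3) * (-y2 k + y2 (k + 1))) /
            (y1 k * (y1 (k + 1) - 2 * y1 (k + 2) + y1 (k + 3)) +
              y1 (k + 1) * (-2 * y1 (k + 1) + 5 * y1 (k + 2) - 2 * y1 (k + 3)) +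
              y1 (k + 2) * (-2 * y1 (k + 2) + y1 (k + 3)))) →
        (∀ k : ℤ, x1 (k + 1) = x1 k + u1 k) ∧
        (∀ k : ℤ, x2 (k + 1) = x2 k + u2 k) ∧
        (∀ k : ℤ, x3 (k + 1) = x3 k + u1 k * u2 k) ∧
        (∀ k : ℤ, y1 k = x1 (k - 1)) ∧
        (∀ k : ℤ, y2 k = x3 k - x2 k * (x1 k - x1 (k - 1)))) := by
  constructor
  · intro x1 x2 x3 u1 u2 hx1 hx2 hx3 y1 y2 D hy1 hy2 hD k hk
    have hy1s : ∀ j : ℤ, y1 (j + 1) = x1 j := fun j => by rw [hy1, add_sub_cancel_right]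
    have hu1 : ∀ j : ℤ, u1 j = y1 (j + 2) - y1 (j + 1) := fun j => by
      rw [hy1s, show j + 2 = j + 1 + 1 by ring, hy1s, hx1]
      ring
    have hout : ∀ j : ℤ, y2 j = x3 j - x2 j * (y1 (j + 1) - y1 j) := fun j => by
      rw [hy2, hy1s, hy1]
    have houts : ∀ j : ℤ, y2 (j + 1) = x3 j - x2 j * (y1 (j + 2) - y1 (j + 1)) := fun j => by
      rw [hout, hx3, hx2, add_assoc j 1 1, one_add_one_eq_two, hu1]
      ring
    have hx2y : ∀ j : ℤ, D j ≠ 0 → x2 j = (y2 j - y2 (j + 1)) / D j := fun j hj => by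
      rw [eq_div_iff hj, hout j, houts j, hD]
      ring
    refine ⟨(hy1s k).symm, hx2y k hk, ?_, hu1 k, fun hk' => ?_⟩
    · rw [eq_div_iff hk, hout k, houts k, hD]
      ring
    · have hu2 : u2 k = x2 (k + 1) - x2 k := by rw [hx2]; ring
      have hD' := hD (k + 1)
      simp only [add_assoc, Int.reduceAdd] at hD'
      rw [hu2, hx2y k hk, hx2y (k + 1) hk', hD', hD k, add_assoc k 1 1, one_add_one_eq_two]
      rw [hD k] at hk
      rw [hD'] at hk'
      exact div_second_diff_sub_div_second_diff hk hk'
  · intro y1 y2 D hD hD0 x1 x2 x3 u1 u2 hx1 hx2 hx3 hu1 hu2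
    have hy1 : ∀ k : ℤ, y1 k = x1 (k - 1) := fun k => by rw [hx1, sub_add_cancel]
    have hx2s : ∀ k : ℤ, x2 (k + 1) = x2 k + u2 k := fun k => by
      have hk := hD0 k
      have hk' := hD0 (k + 1)
      have hD' := hD (k + 1)
      simp only [add_assoc, Int.reduceAdd] at hD'
      rw [← sub_eq_iff_eq_add', hu2, hx2 k, hx2 (k + 1), hD', hD k, add_assoc k 1 1,
        one_add_one_eq_two]
      rw [hD k] at hk
      rw [hD'] at hk'
      exact div_second_diff_sub_div_second_diff hk hk'
    have hx3y : ∀ k : ℤ, x3 k = y2 k + x2 k * (y1 (k + 1) - y1 k) := fun k => by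
      have hk := hD0 k
      rw [hx3, hx2]
      field_simp
      rw [hD]
      ring
    have hx3ys : ∀ k : ℤ, x3 k = y2 (k + 1) + x2 k * (y1 (k + 2) - y1 (k + 1)) := fun k => by
      have hk := hD0 k
      rw [hx3, hx2]
      field_simp
      rw [hD]
      ring
    refine ⟨fun k => ?_, hx2s, fun k => ?_, hy1, fun k => ?_⟩
    · rw [hx1, hx1, hu1, add_assoc k 1 1, one_add_one_eq_two]
      ring
    · rw [hx3y (k + 1), hx3ys k, hx2s, hu1, add_assoc k 1 1, one_add_one_eq_two]
      ring
    · rw [hx3y k, ← hy1, hx1]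
      ring

end
end

section
/- Consider the linear time-varying system Δx¹(k+1) = Δx¹(k) + Δu¹(k), Δx²(k+1) = Δx²(k) + Δu²(k), Δx³(k+1) = Δx³(k) − kΔu¹(k) + kΔu²(k), which is the linearization of the system x¹(k+1)=x¹(k)+u¹(k), x²(k+1)=x²(k)+u²(k), x³(k+1)=x³(k)+u¹(k)u²(k) along its trajectory x¹(k) = (1/2)k(k−1), x²(k) = −(1/2)k(k−1), x³(k) = −(1/6)k(k−1)(2k−1), u¹(k) = k, u²(k) = −k. For a trajectory (Δx,Δu) of the linear system define Δy¹(k) := Δx¹(k−1) and Δy²(k) := Δx³(k) − (k−1)Δx²(k) + (1/2)k(k−1)(Δx¹(k) − Δx¹(k−1)). Then: (a) for every trajectory (Δx,Δu) and every k ∈ ℤ: Δx¹(k) = Δy¹(k+1); Δx²(k) = (1/2)k(k−1)(Δy¹(k) − 2Δy¹(k+1) + Δy¹(k+2)) + Δy²(k) − Δy²(k+1); Δx³(k) = (1/2)k(k−1)(kΔy¹(k) − (2k−1)Δy¹(k+1) + (k−1)Δy¹(k+2)) + kΔy²(k) + (1−k)Δy²(k+1); Δu¹(k) = −Δy¹(k+1)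 + Δy¹(k+2); Δu²(k) = (1/2)k((1−k)Δy¹(k) + (3k−1)Δy¹(k+1) − (3k+1)Δy¹(k+2)) + (1/2)k(k+1)Δy¹(k+3) − Δy²(k) + 2Δy²(k+1) − Δy²(k+2). (b) Conversely, every sequence Δy : ℤ → ℝ² generates via the formulas in (a) a trajectory (Δx,Δu) of the linear system whose associated sequences Δy¹, Δy² as defined above coincide with Δy. Hence (Δy¹,Δy²) is a flat output of the linearized system. -/
noncomputable section

/-- For the linear time-varying system
`Δx¹⁺ = Δx¹ + Δu¹`, `Δx²⁺ = Δx² + Δu²`, `Δx³⁺ = Δx³ - kΔu¹ + kΔu²`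
(the linearization of the product example along the trajectory
`x¹ = k(k-1)/2`, `x² = -k(k-1)/2`, `x³ = -k(k-1)(2k-1)/6`, `u¹ = k`,
`u² = -k`), the output `Δy¹(k) = Δx¹(k-1)`,
`Δy²(k) = Δx³(k) - (k-1)Δx²(k) + k(k-1)/2·(Δx¹(k) - Δx¹(k-1))` is a flat
output with the stated linear parameterization. -/
theorem linearized_product_example_flat :
    -- (a)
    (∀ Dx1 Dx2 Dx3 Du1 Du2 : ℤ → ℝ,
      (∀ k : ℤ, Dx1 (k + 1) = Dx1 k + Du1 k) →
      (∀ k : ℤ, Dx2 (k + 1) = Dx2 k + Du2 k) →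
      (∀ k : ℤ, Dx3 (k + 1) = Dx3 k - (k : ℝ) * Du1 k + (k : ℝ) * Du2 k) →
      ∀ Dy1 Dy2 : ℤ → ℝ,
        (∀ j : ℤ, Dy1 j = Dx1 (j - 1)) →
        (∀ j : ℤ, Dy2 j = Dx3 j - ((j : ℝ) - 1) * Dx2 j +
            (1 / 2 : ℝ) * (j : ℝ) * ((j : ℝ) - 1) * (Dx1 j - Dx1 (j - 1))) →
        ∀ k : ℤ,
          Dx1 k = Dy1 (k + 1) ∧
          Dx2 k = (1 / 2 : ℝ) * (k : ℝ) * ((k : ℝ) - 1) *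
              (Dy1 k - 2 * Dy1 (k + 1) + Dy1 (k + 2)) + Dy2 k - Dy2 (k + 1) ∧
          Dx3 k = (1 / 2 : ℝ) * (k : ℝ) * ((k : ℝ) - 1) *
              ((k : ℝ) * Dy1 k - (2 * (k : ℝ) - 1) * Dy1 (k + 1) +
                ((k : ℝ) - 1) * Dy1 (k + 2)) +
              (k : ℝ) * Dy2 k + (1 - (k : ℝ)) * Dy2 (k + 1) ∧
          Du1 k = -Dy1 (k + 1) + Dy1 (k + 2) ∧
          Du2 k = (1 / 2 : ℝ) * (k : ℝ) *
              ((1 - (k : ℝ)) * Dy1 k + (3 * (k : ℝ) - 1) * Dy1 (k + 1) -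
                (3 * (k : ℝ) + 1) * Dy1 (k + 2)) +
              (1 / 2 : ℝ) * (k : ℝ) * ((k : ℝ) + 1) * Dy1 (k + 3) -
              Dy2 k + 2 * Dy2 (k + 1) - Dy2 (k + 2)) ∧
    -- (b)
    (∀ Dy1 Dy2 : ℤ → ℝ, ∀ Dx1 Dx2 Dx3 Du1 Du2 : ℤ → ℝ,
      (∀ k : ℤ, Dx1 k = Dy1 (k + 1)) →
      (∀ k : ℤ, Dx2 k = (1 / 2 : ℝ) * (k : ℝ) * ((k : ℝ) - 1) *
          (Dy1 k - 2 * Dy1 (k + 1) + Dy1 (k + 2)) + Dy2 k - Dy2 (k + 1)) →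
      (∀ k : ℤ, Dx3 k = (1 / 2 : ℝ) * (k : ℝ) * ((k : ℝ) - 1) *
          ((k : ℝ) * Dy1 k - (2 * (k : ℝ) - 1) * Dy1 (k + 1) +
            ((k : ℝ) - 1) * Dy1 (k + 2)) +
          (k : ℝ) * Dy2 k + (1 - (k : ℝ)) * Dy2 (k + 1)) →
      (∀ k : ℤ, Du1 k = -Dy1 (k + 1) + Dy1 (k + 2)) →
      (∀ k : ℤ, Du2 k = (1 / 2 : ℝ) * (k : ℝ) *
          ((1 - (k : ℝ)) * Dy1 k + (3 * (k : ℝ) - 1) * Dy1 (k + 1) -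
            (3 * (k : ℝ) + 1) * Dy1 (k + 2)) +
          (1 / 2 : ℝ) * (k : ℝ) * ((k : ℝ) + 1) * Dy1 (k + 3) -
          Dy2 k + 2 * Dy2 (k + 1) - Dy2 (k + 2)) →
      (∀ k : ℤ, Dx1 (k + 1) = Dx1 k + Du1 k) ∧
      (∀ k : ℤ, Dx2 (k + 1) = Dx2 k + Du2 k) ∧
      (∀ k : ℤ, Dx3 (k + 1) = Dx3 k - (k : ℝ) * Du1 k + (k : ℝ) * Du2 k) ∧
      (∀ k : ℤ, Dx1 (k - 1) = Dy1 k) ∧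
      (∀ k : ℤ, Dx3 k - ((k : ℝ) - 1) * Dx2 k +
          (1 / 2 : ℝ) * (k : ℝ) * ((k : ℝ) - 1) * (Dx1 k - Dx1 (k - 1)) =
        Dy2 k)) := by
  constructor
  · intro x₁ x₂ x₃ u₁ u₂ h₁ h₂ h₃ y₁ y₂ hy₁ hy₂
    have hx₁ (k : ℤ) : x₁ k = y₁ (k + 1) := by rw [hy₁, add_sub_cancel_right]
    have hu₁ (k : ℤ) : u₁ k = -y₁ (k + 1) + y₁ (k + 2) := by
      have h := h₁ k
      rw [hx₁, hx₁, show k + 1 + 1 = k + 2 by ring] at h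
      linarith
    have hy₂_succ (k : ℤ) : y₂ (k + 1) =
        x₃ k - (k : ℝ) * x₂ k + (1 / 2 : ℝ) * k * (k - 1) * u₁ k := by
      rw [hy₂, add_sub_cancel_right, h₁, h₂, h₃]
      push_cast
      ring
    have hx₂ (k : ℤ) : x₂ k = (1 / 2 : ℝ) * k * (k - 1) *
        (y₁ k - 2 * y₁ (k + 1) + y₁ (k + 2)) + y₂ k - y₂ (k + 1) := by
      rw [hy₂_succ, hy₂ k, ← hy₁, hx₁, hu₁]
      ring
    have hu₂ (k : ℤ) : u₂ k = x₂ (k + 1) - x₂ k := by rw [h₂]; ring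
    intro k
    refine ⟨hx₁ k, hx₂ k, ?_, hu₁ k, ?_⟩
    · rw [hy₂_succ, hy₂ k, ← hy₁, hx₁, hu₁]
      ring
    · rw [hu₂, hx₂, hx₂, show k + 1 + 1 = k + 2 by ring, show k + 1 + 2 = k + 3 by ring]
      push_cast
      ring
  · intro y₁ y₂ x₁ x₂ x₃ u₁ u₂ hx₁ hx₂ hx₃ hu₁ hu₂
    have hadd₂ (k : ℤ) : k + 1 + 1 = k + 2 := by ring
    have hadd₃ (k : ℤ) : k + 1 + 2 = k + 3 := by ring
    refine ⟨fun k => ?_, fun k => ?_, fun k => ?_, fun k => ?_, fun k => ?_⟩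
    · rw [hx₁, hx₁, hu₁, hadd₂]
      ring
    · rw [hx₂, hx₂, hu₂, hadd₂, hadd₃]
      push_cast
      ring
    · rw [hx₃, hx₃, hu₁, hu₂, hadd₂, hadd₃]
      push_cast
      ring
    · rw [hx₁, sub_add_cancel]
    · rw [hx₃, hx₂, hx₁, hx₁, sub_add_cancel]
      ring

end
end

section
/- Consider the map f : ℝ³ × ℝ² → ℝ³, f((x¹,x²,x³),(u¹,u²)) := (−sin(x¹−x³) + u², (1 − sin(x¹−x³))u¹, u²). Then the product of the partial Jacobians of f with respect to the state and the input vanishes identically: for all (x,u), (x̃,ũ) ∈ ℝ³ × ℝ², the composition D_x f(x,u) ∘ D_u f(x̃,ũ) : ℝ² → ℝ³ is the zero map. In particular, for any trajectory of the system x(k+1) = f(x(k),u(k)), the matrices A(k) := D_x f(x(k),u(k)) and B(k) := D_u f(x(k),u(k)) of the linearization satisfy A(k)B(j) = 0 for all k, j ∈ ℤ. -/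
noncomputable section

/-- The map of the second example,
`f((x¹,x²,x³),(u¹,u²)) = (-sin(x¹-x³) + u², (1-sin(x¹-x³))u¹, u²)`. -/
def exSys : (ℝ × ℝ × ℝ) × (ℝ × ℝ) → ℝ × ℝ × ℝ :=
  fun p => (-Real.sin (p.1.1 - p.1.2.2) + p.2.2,
    (1 - Real.sin (p.1.1 - p.1.2.2)) * p.2.1, p.2.2)

/-- The difference of the first and third coordinates, through which `exSys` depends on the
state. -/
def stateDiff : ℝ × ℝ × ℝ →L[ℝ] ℝ :=
  .fst ℝ ℝ (ℝ × ℝ) - (ContinuousLinearMap.snd ℝ ℝ ℝ).comp (.snd ℝ ℝ (ℝ × ℝ))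

theorem hasFDerivAt_exSys_state (x : ℝ × ℝ × ℝ) (u : ℝ × ℝ) :
    HasFDerivAt (fun x' => exSys (x', u))
      (stateDiff.smulRight
        (-Real.cos (stateDiff x), -Real.cos (stateDiff x) * u.1, (0 : ℝ))) x := by
  have hs := stateDiff.hasFDerivAt (x := x) |>.sin
  have h := (hs.neg.add_const u.2).prodMk
    (((hs.const_sub 1).mul_const u.1).prodMk (hasFDerivAt_const u.2 x))
  refine HasFDerivAt.congr_fderiv h ?_
  ext <;> simp [mul_comm, mul_left_comm]

theorem hasFDerivAt_exSys_input (x : ℝ × ℝ × ℝ) (u : ℝ × ℝ) :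
    HasFDerivAt (fun u' => exSys (x, u'))
      ((ContinuousLinearMap.snd ℝ ℝ ℝ).prod
        (((1 - Real.sin (stateDiff x)) • ContinuousLinearMap.fst ℝ ℝ ℝ).prod
          (ContinuousLinearMap.snd ℝ ℝ ℝ))) u :=
  HasFDerivAt.prodMk (f₁ := fun u' : ℝ × ℝ => -Real.sin (stateDiff x) + u'.2)
    (f₂ := fun u' : ℝ × ℝ => ((1 - Real.sin (stateDiff x)) * u'.1, u'.2))
    (hasFDerivAt_snd.const_add _) ((hasFDerivAt_fst.const_mul _).prodMk hasFDerivAt_snd)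

theorem fderiv_exSys_state_comp_fderiv_exSys_input (x xt : ℝ × ℝ × ℝ) (u ut : ℝ × ℝ) :
    (fderiv ℝ (fun x' => exSys (x', u)) x).comp
      (fderiv ℝ (fun u' => exSys (xt, u')) ut) = 0 := by
  rw [(hasFDerivAt_exSys_state x u).fderiv, (hasFDerivAt_exSys_input xt ut).fderiv]
  ext <;> simp [stateDiff]

/-- The product of the partial Jacobians of `exSys` with
respect to state and input vanishes identically:
`D_x f(x,u) ∘ D_u f(x̃,ũ) = 0` for all `(x,u)`, `(x̃,ũ)`. In particular the
matrices `A(k) = D_x f(x(k),u(k))`, `B(k) = D_u f(x(k),u(k))` of the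
linearization along any trajectory satisfy `A(k) B(j) = 0` for all `k, j`. -/
theorem exSys_jacobian_product_vanishes :
    (∀ (x xt : ℝ × ℝ × ℝ) (u ut : ℝ × ℝ),
      (fderiv ℝ (fun x' => exSys (x', u)) x).comp
        (fderiv ℝ (fun u' => exSys (xt, u')) ut) = 0) ∧
    (∀ (x : ℤ → ℝ × ℝ × ℝ) (u : ℤ → ℝ × ℝ),
      (∀ k : ℤ, x (k + 1) = exSys (x k, u k)) →
      ∀ k j : ℤ,
        (fderiv ℝ (fun x' => exSys (x', u k)) (x k)).comp
          (fderiv ℝ (fun u' => exSys (x j, u')) (u j)) = 0) := by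
  exact ⟨fderiv_exSys_state_comp_fderiv_exSys_input,
    fun x u _ k j => fderiv_exSys_state_comp_fderiv_exSys_input (x k) (x j) (u k) (u j)⟩

end
end
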